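/- For every positive integer k, the numerical semigroup generated by S = {12k+4, 18k+3, 18k+5} is a 3-permutation numerical semigroup. -/

import Mathlib

/-- The increasing enumeration of the positive elements of a submonoid `G` of `ℕ`
(0-indexed: `posSeq G 0` is the smallest positive element `g₁` of `G`). -/
noncomputable def posSeq (G : AddSubmonoid ℕ) : ℕ → ℕ :=
  Nat.nth (fun x => x ∈ G ∧ 0 < x)

/-- `G` is an `n`-permutation numerical semigroup: `G` is a cofinite submonoid of `ℕ`,
it is generated by its `n` smallest positive elements `g₁ < ⋯ < gₙ`, and for every
`k ≥ 0` the tuple `(g_{kn+1} mod n, …, g_{kn+n} mod n)` contains exactly one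
representative of each residue class of `ℤ/nℤ`. -/
def IsPermutationSemigroup (n : ℕ) (G : AddSubmonoid ℕ) : Prop :=
  ((G : Set ℕ)ᶜ).Finite ∧
  G = AddSubmonoid.closure (posSeq G '' Set.Iio n) ∧
  ∀ k : ℕ, Function.Bijective (fun j : Fin n => ((posSeq G (k * n + j.val) : ℕ) : ZMod n))

namespace Fam12

/-- `x` lies in the level `L` of the semigroup. -/
def Lv (k L x : ℕ) : Prop :=
  6 * (k * L) + L + (4 * L) % 6 ≤ x ∧ x + L % 2 ≤ 6 * (k * L) + 2 * L ∧ x % 2 = L % 2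

def M (k x : ℕ) : Prop := ∃ L, Lv k L x

theorem mem_iff (k x : ℕ) :
    x ∈ AddSubmonoid.closure ({12 * k + 4, 18 * k + 3, 18 * k + 5} : Set ℕ) ↔ M k x := by
  constructor
  · intro h
    induction h using AddSubmonoid.closure_induction with
    | mem y hy =>
      simp only [Set.mem_insert_iff, Set.mem_singleton_iff] at hy
      rcases hy with h | h | h
      · exact ⟨2, by unfold Lv; omega⟩
      · exact ⟨3, by unfold Lv; omega⟩
      · exact ⟨3, by unfold Lv; omega⟩
    | zero => exact ⟨0, by unfold Lv; omega⟩
    | add a b _ _ ha hb =>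
      obtain ⟨L, h1, h2, h3⟩ := ha
      obtain ⟨L', h1', h2', h3'⟩ := hb
      refine ⟨L + L', ?_⟩
      unfold Lv
      rw [Nat.mul_add k L L']
      generalize k * L = q at *
      generalize k * L' = q' at *
      refine ⟨?_, ?_, ?_⟩ <;> omega
  · rintro ⟨L, h1, h2, h3⟩
    obtain ⟨s, hs⟩ : ∃ s, x + s = 6 * (k * L) + 2 * L := ⟨6 * (k * L) + 2 * L - x, by omega⟩
    have hsL : s + (4 * L) % 6 ≤ L := by omega
    have hsp : s % 2 = L % 2 := by omega
    have hj : ∃ j, j ≤ s ∧ s ≤ 3 * j ∧ j % 2 = s % 2 ∧ 3 * j ≤ L := by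
      have : s % 6 = 0 ∨ s % 6 = 1 ∨ s % 6 = 2 ∨ s % 6 = 3 ∨ s % 6 = 4 ∨ s % 6 = 5 := by omega
      rcases this with h | h | h | h | h | h
      · exact ⟨2 * (s / 6), by omega⟩
      · exact ⟨2 * (s / 6) + 1, by omega⟩
      · exact ⟨2 * (s / 6) + 2, by omega⟩
      · exact ⟨2 * (s / 6) + 1, by omega⟩
      · exact ⟨2 * (s / 6) + 2, by omega⟩
      · exact ⟨2 * (s / 6) + 3, by omega⟩
    obtain ⟨j, hj1, hj2, hj3, hj4⟩ := hj
    obtain ⟨i, hi⟩ : ∃ i, L = 2 * i + 3 * j := ⟨(L - 3 * j) / 2, by omega⟩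
    obtain ⟨t, ht⟩ : ∃ t, s + 2 * t = 3 * j := ⟨(3 * j - s) / 2, by omega⟩
    obtain ⟨u, hu⟩ : ∃ u, j = t + u := ⟨j - t, by omega⟩
    have hx : x = i • (12 * k + 4) + u • (18 * k + 3) + t • (18 * k + 5) := by
      subst hi
      subst hu
      simp only [smul_eq_mul]
      nlinarith
    rw [hx]
    refine add_mem (add_mem ?_ ?_) ?_ <;> apply nsmul_mem <;> apply AddSubmonoid.subset_closure <;> simp

theorem gap {k y : ℕ} (hk : 0 < k) (hy : M k y) (L : ℕ) (hp : y % 2 = L % 2) :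
    y + L % 2 ≤ 6 * (k * L) + 2 * L ∨
      6 * (k * (L + 2)) + (L + 2) + (4 * (L + 2)) % 6 ≤ y := by
  obtain ⟨L', h1, h2, h3⟩ := hy
  rcases Nat.lt_or_ge L L' with h | h
  · right
    obtain ⟨d, rfl⟩ : ∃ d, L' = L + 2 + d := ⟨L' - (L + 2), by omega⟩
    have e : k * (L + 2 + d) = k * (L + 2) + k * d := by ring
    have : d ≤ k * d := Nat.le_mul_of_pos_left d hk
    rw [e] at h1
    clear e
    rcases Nat.eq_zero_or_pos d with h0 | h0
    · subst h0
      simp only [Nat.add_zero] at h1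
      omega
    · have := Nat.mod_lt (4 * (L + 2)) (show 6 > 0 by omega)
      omega
  · left
    have := Nat.mul_le_mul_left k h
    generalize k * L = q at *
    generalize k * L' = q' at *
    omega

/-- The starters of the triples. -/
def T (k x : ℕ) : Prop :=
  (72 * (k * k) + 36 * k + 7 ≤ x ∧ x % 3 = 1) ∨
  ∃ P, P ≤ 6 * k ∧
   ((x % 2 = 0 ∧ 12 * (k * P) + 6 * k + 4 * P + 1 < x ∧
      12 * (k * P) + 12 * k + 2 * P + 2 + (8 * P + 8) % 6 ≤ x ∧
      x ≤ 12 * (k * P) + 12 * k + 4 * P + 4 ∧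
      x < 12 * (k * P) + 18 * k + 2 * P + 3 + (8 * P + 12) % 6 ∧ x % 3 = (P + 1) % 3) ∨
    (12 * (k * P) + 18 * k + 2 * P + 3 + (8 * P + 12) % 6 ≤ x ∧
      x ≤ 12 * (k * P) + 12 * k + 4 * P + 4 ∧ x % 3 = P % 3) ∨
    (P < 6 * k ∧ x % 2 = 1 ∧ 12 * (k * P) + 18 * k + 2 * P + 3 + (8 * P + 12) % 6 ≤ x ∧
      x ≤ 12 * (k * P) + 18 * k + 4 * P + 5 ∧
      12 * (k * P) + 12 * k + 4 * P + 4 < x ∧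
      x + 1 < 12 * (k * P) + 24 * k + 2 * P + 4 + (8 * P + 16) % 6 ∧ x % 3 = (P + 1) % 3) ∨
    (P < 6 * k ∧ 12 * (k * P) + 24 * k + 2 * P + 4 + (8 * P + 16) % 6 ≤ x + 1 ∧
      x < 12 * (k * P) + 18 * k + 4 * P + 5 ∧ x % 3 = (P + 1) % 3))

theorem final {k : ℕ} (hk : 0 < k) (x : ℕ) (hx : 72 * (k * k) + 36 * k + 7 ≤ x) : M k x := by
  suffices h : ∃ L, 12 * k + 3 ≤ L ∧ Lv k L x by
    obtain ⟨L, _, h⟩ := h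
    exact ⟨L, h⟩
  induction x using Nat.strong_induction_on with
  | _ x ih =>
    by_cases hs : x < 72 * (k * k) + 36 * k + 9
    · rcases Nat.mod_two_eq_zero_or_one x with h | h
      · refine ⟨12 * k + 4, by omega, ?_⟩
        unfold Lv
        have e : k * (12 * k + 4) = 12 * (k * k) + 4 * k := by ring
        rw [e]
        generalize k * k = q at *
        omega
      · refine ⟨12 * k + 3, by omega, ?_⟩
        unfold Lv
        have e : k * (12 * k + 3) = 12 * (k * k) + 3 * k := by ring
        rw [e]
        generalize k * k = q at *
        omega
    · obtain ⟨L, hL, h1, h2, h3⟩ := ih (x - 2) (by omega) (by omega)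
      by_cases hh : x + L % 2 ≤ 6 * (k * L) + 2 * L
      · exact ⟨L, hL, by omega, hh, by omega⟩
      · refine ⟨L + 2, by omega, ?_⟩
        unfold Lv
        have e : k * (L + 2) = k * L + 2 * k := by ring
        rw [e]
        clear e ih
        generalize k * L = q at h1 h2 hh ⊢
        have hLc : L = 12 * k + 3 ∨ L = 12 * k + 4 ∨ 12 * k + 5 ≤ L := by omega
        rcases hLc with h | h | h
        · subst h
          omega
        · subst h
          omega
        · have : (4 * (L + 2)) % 6 ≤ 4 := by omega
          generalize (4 * (L + 2)) % 6 = r at *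
          refine ⟨?_, ?_, ?_⟩ <;> omega

theorem gaps {k y : ℕ} (hk : 0 < k) (hy : M k y) (P : ℕ) :
    (y % 2 = 1 → y ≤ 12 * (k * P) + 6 * k + 4 * P + 1 ∨
      12 * (k * P) + 18 * k + 2 * P + 3 + (8 * P + 12) % 6 ≤ y) ∧
    (y % 2 = 0 → y ≤ 12 * (k * P) + 12 * k + 4 * P + 4 ∨
      12 * (k * P) + 24 * k + 2 * P + 4 + (8 * P + 16) % 6 ≤ y) ∧
    (y % 2 = 1 → y ≤ 12 * (k * P) + 18 * k + 4 * P + 5 ∨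
      12 * (k * P) + 30 * k + 2 * P + 5 + (8 * P + 20) % 6 ≤ y) := by
  have e1 : k * (2 * P + 1) = 2 * (k * P) + k := by ring
  have e2 : k * (2 * P + 2) = 2 * (k * P) + 2 * k := by ring
  have e3 : k * (2 * P + 1 + 2) = 2 * (k * P) + 3 * k := by ring
  have e3' : k * (2 * P + 3) = 2 * (k * P) + 3 * k := by ring
  have e4 : k * (2 * P + 2 + 2) = 2 * (k * P) + 4 * k := by ring
  have e5 : k * (2 * P + 3 + 2) = 2 * (k * P) + 5 * k := by ring
  have g1 := gap hk hy (2 * P + 1)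
  have g2 := gap hk hy (2 * P + 2)
  have g3 := gap hk hy (2 * P + 3)
  rw [e1, e3] at g1
  rw [e2, e4] at g2
  rw [e3', e5] at g3
  generalize k * P = q at *
  refine ⟨fun h => ?_, fun h => ?_, fun h => ?_⟩
  · have := g1 (by omega)
    omega
  · have := g2 (by omega)
    omega
  · have := g3 (by omega)
    omega

theorem mE {k x : ℕ} (P : ℕ) (h0 : x % 2 = 0)
    (h1 : 12 * (k * P) + 12 * k + 2 * P + 2 + (8 * P + 8) % 6 ≤ x)
    (h2 : x ≤ 12 * (k * P) + 12 * k + 4 * P + 4) : M k x := by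
  refine ⟨2 * P + 2, ?_⟩
  have e2 : k * (2 * P + 2) = 2 * (k * P) + 2 * k := by ring
  unfold Lv
  rw [e2]
  omega

theorem mO {k x : ℕ} (P : ℕ) (h0 : x % 2 = 1)
    (h1 : 12 * (k * P) + 18 * k + 2 * P + 3 + (8 * P + 12) % 6 ≤ x)
    (h2 : x ≤ 12 * (k * P) + 18 * k + 4 * P + 5) : M k x := by
  refine ⟨2 * P + 3, ?_⟩
  have e2 : k * (2 * P + 3) = 2 * (k * P) + 3 * k := by ring
  unfold Lv
  rw [e2]
  omega

theorem mE' {k x : ℕ} (P : ℕ) (h0 : x % 2 = 0)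
    (h1 : 12 * (k * P) + 24 * k + 2 * P + 4 + (8 * P + 16) % 6 ≤ x)
    (h2 : x ≤ 12 * (k * P) + 24 * k + 4 * P + 8) : M k x := by
  refine ⟨2 * P + 4, ?_⟩
  have e2 : k * (2 * P + 4) = 2 * (k * P) + 4 * k := by ring
  unfold Lv
  rw [e2]
  omega

def Nx (k x : ℕ) : Prop := ∃ a b c, x < a ∧ a < b ∧ b < c ∧ M k a ∧ M k b ∧ T k c ∧
  (∀ y, M k y → x < y → y < c → y = a ∨ y = b) ∧
  x % 3 ≠ a % 3 ∧ x % 3 ≠ b % 3 ∧ a % 3 ≠ b % 3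

theorem step1 {k x P : ℕ} (hk : 0 < k) (hP : P ≤ 6 * k)
   (h : x % 2 = 0 ∧ 12 * (k * P) + 6 * k + 4 * P + 1 < x ∧
      12 * (k * P) + 12 * k + 2 * P + 2 + (8 * P + 8) % 6 ≤ x ∧
      x ≤ 12 * (k * P) + 12 * k + 4 * P + 4 ∧
      x < 12 * (k * P) + 18 * k + 2 * P + 3 + (8 * P + 12) % 6 ∧ x % 3 = (P + 1) % 3) :
   Nx k x := by
  have G := fun y (hy : M k y) => gaps hk hy P
  have eP : k * (P + 1) = k * P + k := by ring
  by_cases hc : x = 12 * (k * P) + 12 * k + 4 * P + 4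
  · have hP' : P < 6 * k := by omega
    obtain ⟨m, hm⟩ : ∃ m, m = 12 * (k * P) + 18 * k + 2 * P + 3 + (8 * P + 12) % 6 := ⟨_, rfl⟩
    by_cases hd : m + 4 ≤ 12 * (k * P) + 18 * k + 4 * P + 5
    · refine ⟨m, m + 2, m + 4, by omega, by omega, by omega, mO P (by omega) (by omega) (by omega),
        mO P (by omega) (by omega) (by omega), Or.inr ⟨P, hP, Or.inr (Or.inr ?_)⟩, ?_, by omega, by omega, by omega⟩
      · omega
      · intro y hy h1 h2
        have := G y hy
        omega
    · refine ⟨m, m + 2, 12 * (k * P) + 24 * k + 2 * P + 4 + (8 * P + 16) % 6, by omega, by omega, by omega, mO P (by omega) (by omega) (by omega),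
        mO P (by omega) (by omega) (by omega), Or.inr ⟨P + 1, by omega, Or.inl ?_⟩, ?_, by omega, by omega, by omega⟩
      · rw [eP]; omega
      · intro y hy h1 h2
        have := G y hy
        omega
  · by_cases hd : x + 6 < 12 * (k * P) + 18 * k + 2 * P + 3 + (8 * P + 12) % 6
    · refine ⟨x + 2, x + 4, x + 6, by omega, by omega, by omega, mE P (by omega) (by omega) (by omega),
        mE P (by omega) (by omega) (by omega), Or.inr ⟨P, hP, Or.inl ?_⟩, ?_, by omega, by omega, by omega⟩
      · omega
      · intro y hy h1 h2
        have := G y hy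
        omega
    · refine ⟨x + 2, x + 4, x + 5, by omega, by omega, by omega, mE P (by omega) (by omega) (by omega),
        mE P (by omega) (by omega) (by omega), Or.inr ⟨P, hP, Or.inr (Or.inl ?_)⟩, ?_, by omega, by omega, by omega⟩
      · omega
      · intro y hy h1 h2
        have := G y hy
        omega

theorem step2 {k x P : ℕ} (hk : 0 < k) (hP : P ≤ 6 * k)
   (h : 12 * (k * P) + 18 * k + 2 * P + 3 + (8 * P + 12) % 6 ≤ x ∧
      x ≤ 12 * (k * P) + 12 * k + 4 * P + 4 ∧ x % 3 = P % 3) :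
   Nx k x := by
  have G := fun y (hy : M k y) => gaps hk hy P
  have m1 : M k (x + 1) := by
    rcases Nat.mod_two_eq_zero_or_one x with h | h
    · exact mO P (by omega) (by omega) (by omega)
    · exact mE P (by omega) (by omega) (by omega)
  have m2 : M k (x + 2) := by
    rcases Nat.mod_two_eq_zero_or_one x with h | h
    · exact mE P (by omega) (by omega) (by omega)
    · exact mO P (by omega) (by omega) (by omega)
  by_cases hc : x + 3 ≤ 12 * (k * P) + 12 * k + 4 * P + 4
  · exact ⟨x + 1, x + 2, x + 3, by omega, by omega, by omega, m1, m2,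
      Or.inr ⟨P, hP, Or.inr (Or.inl (by omega))⟩, fun y _ _ _ => by omega, by omega, by omega, by omega⟩
  · refine ⟨x + 1, x + 2, x + 4, by omega, by omega, by omega, m1, m2, ?_, ?_, by omega, by omega, by omega⟩
    · by_cases hP' : P < 6 * k
      · exact Or.inr ⟨P, hP, Or.inr (Or.inr (by omega))⟩
      · left
        have : P = 6 * k := by omega
        have e : k * P = 6 * (k * k) := by rw [this]; ring
        omega
    · intro y hy h1 h2
      have := G y hy
      omega

theorem step3 {k x P : ℕ} (hk : 0 < k) (hP : P ≤ 6 * k)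
   (h : P < 6 * k ∧ x % 2 = 1 ∧ 12 * (k * P) + 18 * k + 2 * P + 3 + (8 * P + 12) % 6 ≤ x ∧
      x ≤ 12 * (k * P) + 18 * k + 4 * P + 5 ∧
      12 * (k * P) + 12 * k + 4 * P + 4 < x ∧
      x + 1 < 12 * (k * P) + 24 * k + 2 * P + 4 + (8 * P + 16) % 6 ∧ x % 3 = (P + 1) % 3) :
   Nx k x := by
  have G := fun y (hy : M k y) => gaps hk hy P
  have eP : k * (P + 1) = k * P + k := by ring
  by_cases hc : x + 6 ≤ 12 * (k * P) + 18 * k + 4 * P + 5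
  · refine ⟨x + 2, x + 4, x + 6, by omega, by omega, by omega, mO P (by omega) (by omega) (by omega),
      mO P (by omega) (by omega) (by omega), Or.inr ⟨P, hP, Or.inr (Or.inr ?_)⟩, ?_, by omega, by omega, by omega⟩
    · omega
    · intro y hy h1 h2
      have := G y hy
      omega
  · refine ⟨x + 2, x + 4, 12 * (k * P) + 24 * k + 2 * P + 4 + (8 * P + 16) % 6, by omega, by omega, by omega, mO P (by omega) (by omega) (by omega),
      mO P (by omega) (by omega) (by omega), Or.inr ⟨P + 1, by omega, Or.inl ?_⟩, ?_, by omega, by omega, by omega⟩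
    · rw [eP]; omega
    · intro y hy h1 h2
      have := G y hy
      omega

theorem step4 {k x P : ℕ} (hk : 0 < k) (hP : P ≤ 6 * k)
   (h : P < 6 * k ∧ 12 * (k * P) + 24 * k + 2 * P + 4 + (8 * P + 16) % 6 ≤ x + 1 ∧
      x < 12 * (k * P) + 18 * k + 4 * P + 5 ∧ x % 3 = (P + 1) % 3) :
   Nx k x := by
  have G := fun y (hy : M k y) => gaps hk hy P
  have eP : k * (P + 1) = k * P + k := by ring
  have m1 : M k (x + 1) := by
    rcases Nat.mod_two_eq_zero_or_one x with h | h
    · exact mO P (by omega) (by omega) (by omega)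
    · exact mE' P (by omega) (by omega) (by omega)
  have m2 : M k (x + 2) := by
    rcases Nat.mod_two_eq_zero_or_one x with h | h
    · exact mE' P (by omega) (by omega) (by omega)
    · exact mO P (by omega) (by omega) (by omega)
  by_cases hc : x + 3 < 12 * (k * P) + 18 * k + 4 * P + 5
  · exact ⟨x + 1, x + 2, x + 3, by omega, by omega, by omega, m1, m2,
      Or.inr ⟨P, hP, Or.inr (Or.inr (by omega))⟩, fun y _ _ _ => by omega, by omega, by omega, by omega⟩
  · by_cases hd : 12 * (k * P) + 30 * k + 2 * P + 5 + (8 * P + 20) % 6 ≤ x + 3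
    · exact ⟨x + 1, x + 2, x + 3, by omega, by omega, by omega, m1, m2,
        Or.inr ⟨P + 1, by omega, Or.inr (Or.inl (by rw [eP]; omega))⟩, fun y _ _ _ => by omega, by omega, by omega, by omega⟩
    · refine ⟨x + 1, x + 2, x + 4, by omega, by omega, by omega, m1, m2,
        Or.inr ⟨P + 1, by omega, Or.inl (by rw [eP]; omega)⟩, ?_, by omega, by omega, by omega⟩
      intro y hy h1 h2
      have := G y hy
      omega

theorem step {k x : ℕ} (hk : 0 < k) (h : T k x) : Nx k x := by
  rcases h with h | ⟨P, hP, h | h | h | h⟩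
  · refine ⟨x + 1, x + 2, x + 3, by omega, by omega, by omega, final hk _ (by omega),
      final hk _ (by omega), Or.inl (by omega), fun y _ _ _ => by omega, by omega, by omega, by omega⟩
  · exact step1 hk hP h
  · exact step2 hk hP h
  · exact step3 hk hP h
  · exact step4 hk hP h

theorem T_mem {k x : ℕ} (hk : 0 < k) (h : T k x) : M k x := by
  rcases h with h | ⟨P, hP, h | h | h | h⟩
  · exact final hk _ h.1
  · exact mE P (by omega) (by omega) (by omega)
  · rcases Nat.mod_two_eq_zero_or_one x with h | h
    · exact mE P (by omega) (by omega) (by omega)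
    · exact mO P (by omega) (by omega) (by omega)
  · exact mO P (by omega) (by omega) (by omega)
  · rcases Nat.mod_two_eq_zero_or_one x with h | h
    · exact mE' P (by omega) (by omega) (by omega)
    · exact mO P (by omega) (by omega) (by omega)

theorem nth_next {p : ℕ → Prop} (hp : {x | p x}.Infinite) {n t a : ℕ} (hn : Nat.nth p n = t)
    (hta : t < a) (ha : p a) (hg : ∀ y, p y → t < y → ¬ y < a) : Nat.nth p (n + 1) = a := by
  have hr : a ∈ Set.range (Nat.nth p) := by
    rw [Nat.range_nth_of_infinite hp]; exact ha
  obtain ⟨m, rfl⟩ := hr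
  have hm := Nat.nth_strictMono hp
  have h1 : n < m := by
    rw [← hn] at hta
    exact hm.lt_iff_lt.1 hta
  have h2 : Nat.nth p (n + 1) ≤ Nat.nth p m := hm.monotone h1
  have h3 := hg _ (Nat.nth_mem_of_infinite hp (n + 1)) (by rw [← hn]; exact hm (Nat.lt_succ_self n))
  exact le_antisymm h2 (not_lt.1 h3)

theorem nth_first {p : ℕ → Prop} (hp : {x | p x}.Infinite) {a : ℕ}
    (ha : p a) (hg : ∀ y, p y → a ≤ y) : Nat.nth p 0 = a := by
  have hr : a ∈ Set.range (Nat.nth p) := by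
    rw [Nat.range_nth_of_infinite hp]; exact ha
  obtain ⟨m, rfl⟩ := hr
  have hm := Nat.nth_strictMono hp
  have h2 : Nat.nth p 0 ≤ Nat.nth p m := hm.monotone (Nat.zero_le m)
  have h3 := hg _ (Nat.nth_mem_of_infinite hp 0)
  exact le_antisymm h2 h3

theorem first_le {k y : ℕ} (hk : 0 < k) (hy : M k y) (h0 : 0 < y) :
    12 * k + 4 ≤ y ∧ (12 * k + 4 < y → 18 * k + 3 ≤ y) ∧ (18 * k + 3 < y → 18 * k + 5 ≤ y) := by
  have hlo : 12 * k + 4 ≤ y := by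
    obtain ⟨L, h1, h2, h3⟩ := hy
    rcases Nat.lt_or_ge L 2 with h | h
    · interval_cases L <;> omega
    · rcases Nat.eq_or_lt_of_le h with h | h
      · subst h
        omega
      · have := Nat.mul_le_mul_left k (show 3 ≤ L from h)
        have h4 := Nat.zero_le ((4 * L) % 6)
        generalize (4 * L) % 6 = r at *
        omega
  have := gaps hk hy 0
  omega

theorem bij {f : Fin 3 → ℕ} (h01 : f 0 % 3 ≠ f 1 % 3) (h02 : f 0 % 3 ≠ f 2 % 3)
    (h12 : f 1 % 3 ≠ f 2 % 3) : Function.Bijective (fun j : Fin 3 => ((f j : ℕ) : ZMod 3)) := by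
  have hi : Function.Injective (fun j : Fin 3 => ((f j : ℕ) : ZMod 3)) := by
    intro i j hij
    have hij' : f i % 3 = f j % 3 := (ZMod.natCast_eq_natCast_iff' _ _ _).1 hij
    fin_cases i <;> fin_cases j <;> simp_all
  exact (Fintype.bijective_iff_injective_and_card _).2 ⟨hi, by simp⟩

end Fam12

open Fam12 in
theorem family12_is_three_permutation (k : ℕ) (hk : 0 < k) :
    IsPermutationSemigroup 3 (AddSubmonoid.closure ({12 * k + 4, 18 * k + 3, 18 * k + 5} : Set ℕ)) := by
  have hps : posSeq (AddSubmonoid.closure ({12 * k + 4, 18 * k + 3, 18 * k + 5} : Set ℕ))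
      = Nat.nth (fun x => M k x ∧ 0 < x) := by
    unfold posSeq
    congr 1
    funext x
    rw [mem_iff]
  have hinf : {x | M k x ∧ 0 < x}.Infinite := by
    refine Set.infinite_of_not_bddAbove ?_
    rintro ⟨B, hB⟩
    have := hB (show B + (72 * (k * k) + 36 * k + 7) ∈ {x | M k x ∧ 0 < x} from
      ⟨final hk _ (by omega), by omega⟩)
    omega
  have n0 : Nat.nth (fun x => M k x ∧ 0 < x) 0 = 12 * k + 4 :=
    nth_first hinf ⟨mE 0 (by omega) (by omega) (by omega), by omega⟩
      (fun y hy => (first_le hk hy.1 hy.2).1)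
  have n1 : Nat.nth (fun x => M k x ∧ 0 < x) 1 = 18 * k + 3 := by
    refine nth_next hinf n0 (by omega) ⟨mO 0 (by omega) (by omega) (by omega), by omega⟩ ?_
    intro y hy h
    have := first_le hk hy.1 hy.2
    omega
  have n2 : Nat.nth (fun x => M k x ∧ 0 < x) 2 = 18 * k + 5 := by
    refine nth_next hinf n1 (by omega) ⟨mO 0 (by omega) (by omega) (by omega), by omega⟩ ?_
    intro y hy h
    have := first_le hk hy.1 hy.2
    omega
  have key : ∀ t n, Nat.nth (fun x => M k x ∧ 0 < x) n = t → T k t →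
      T k (Nat.nth (fun x => M k x ∧ 0 < x) (n + 3)) ∧
      t % 3 ≠ Nat.nth (fun x => M k x ∧ 0 < x) (n + 1) % 3 ∧
      t % 3 ≠ Nat.nth (fun x => M k x ∧ 0 < x) (n + 2) % 3 ∧
      Nat.nth (fun x => M k x ∧ 0 < x) (n + 1) % 3 ≠
        Nat.nth (fun x => M k x ∧ 0 < x) (n + 2) % 3 := by
    intro t n hn hT
    obtain ⟨a, b, c, h1, h2, h3, ha, hb, hc, hy, r⟩ := step hk hT
    have ea : Nat.nth (fun x => M k x ∧ 0 < x) (n + 1) = a :=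
      nth_next hinf hn h1 ⟨ha, by omega⟩ (fun y hy' h h' => by
        have := hy y hy'.1 (by omega) (by omega)
        omega)
    have eb : Nat.nth (fun x => M k x ∧ 0 < x) (n + 2) = b :=
      nth_next hinf ea h2 ⟨hb, by omega⟩ (fun y hy' h h' => by
        have := hy y hy'.1 (by omega) (by omega)
        omega)
    have ec : Nat.nth (fun x => M k x ∧ 0 < x) (n + 3) = c :=
      nth_next hinf eb h3 ⟨T_mem hk hc, by omega⟩ (fun y hy' h h' => by
        have := hy y hy'.1 (by omega) (by omega)
        omega)
    rw [ea, eb, ec]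
    exact ⟨hc, r⟩
  have hT : ∀ n, T k (Nat.nth (fun x => M k x ∧ 0 < x) (n * 3)) := by
    intro n
    induction n with
    | zero =>
      rw [Nat.zero_mul, n0]
      exact Or.inr ⟨0, by omega, Or.inl (by omega)⟩
    | succ n ih =>
      have := (key _ _ rfl ih).1
      rwa [Nat.succ_mul]
  refine ⟨?_, ?_, ?_⟩
  · refine (Set.finite_Iio (72 * (k * k) + 36 * k + 7)).subset ?_
    intro x hx
    by_contra h
    exact hx ((mem_iff k x).2 (final hk x (by simpa using h)))
  · rw [hps]
    congr 1
    ext x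
    constructor
    · rintro (h | h | h)
      · exact ⟨0, by simp, by rw [n0, h]⟩
      · exact ⟨1, by simp, by rw [n1, h]⟩
      · exact ⟨2, by simp, by rw [n2, h]⟩
    · rintro ⟨j, hj, rfl⟩
      have hj' : j < 3 := hj
      interval_cases j
      · rw [n0]; simp
      · rw [n1]; simp
      · rw [n2]; simp
  · intro n
    rw [hps]
    have := key _ _ rfl (hT n)
    exact bij (f := fun j : Fin 3 => Nat.nth (fun x => M k x ∧ 0 < x) (n * 3 + j.val))
      this.2.1 this.2.2.1 this.2.2.2
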